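/- Let E be the shift equivalence relation on a subshift X ⊆ 2^ℤ of finite type, and assume E has uncountably many equivalence classes. Then for every reasonable pointclass Γ, (Γ, E)-determinacy implies Γ-determinacy. -/

import Mathlib

open Filter Set

/-- The position (list of moves) consisting of the first `n` moves of the run `x`. -/
def initSeg {S : Type*} (x : ℕ → S) (n : ℕ) : List S := List.ofFn (fun i : Fin n => x i)

/-- The run `x` is compatible with player I using strategy `σ`. -/
def FollowsStratI {S : Type*} (σ : List S → S) (x : ℕ → S) : Prop :=
  ∀ n, x (2 * n) = σ (initSeg x (2 * n))

/-- The run `x` is compatible with player II using strategy `τ`. -/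
def FollowsStratII {S : Type*} (τ : List S → S) (x : ℕ → S) : Prop :=
  ∀ n, x (2 * n + 1) = τ (initSeg x (2 * n + 1))

/-- The game with payoff set `A` (for player I) is determined. -/
def GameDetermined {S : Type*} (A : Set (ℕ → S)) : Prop :=
  (∃ σ : List S → S, ∀ x, FollowsStratI σ x → x ∈ A) ∨
  (∃ τ : List S → S, ∀ x, FollowsStratII τ x → x ∉ A)

/-- A pointclass: a collection of subsets of topological (in particular Polish) spaces closed
under continuous preimages. -/
structure Pointclass : Type 1 where
  mem : ∀ (X : Type) [TopologicalSpace X], Set (Set X)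
  continuous_preimage : ∀ (X Y : Type) [TopologicalSpace X] [TopologicalSpace Y]
    (f : X → Y), Continuous f → ∀ A : Set Y, A ∈ mem Y → f ⁻¹' A ∈ mem X

/-- `sigmaLevel X n` is the pointclass `Σ⁰_{n+1}` of subsets of `X`. -/
def sigmaLevel (X : Type) [TopologicalSpace X] : ℕ → Set (Set X)
  | 0 => {s | IsOpen s}
  | (n + 1) => {s | ∃ f : ℕ → Set X, (∀ k, (f k)ᶜ ∈ sigmaLevel X n) ∧ s = ⋃ k, f k}

/-- `Δ⁰₆` sets: both `Σ⁰₆` and `Π⁰₆`. -/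
def IsDelta06 {X : Type} [TopologicalSpace X] (s : Set X) : Prop :=
  s ∈ sigmaLevel X 5 ∧ sᶜ ∈ sigmaLevel X 5

/-- A function is `Δ⁰₆`-measurable if preimages of open sets are `Δ⁰₆`. -/
def Delta06Measurable {X Y : Type} [TopologicalSpace X] [TopologicalSpace Y] (f : X → Y) : Prop :=
  ∀ U : Set Y, IsOpen U → IsDelta06 (f ⁻¹' U)

/-- A reasonable pointclass: closed under unions and intersections with `Δ⁰₆` sets and under
substitution by `Δ⁰₆`-measurable functions. -/
structure Reasonable (Γ : Pointclass) : Prop where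
  union_delta : ∀ (X : Type) [TopologicalSpace X] (A B : Set X),
    A ∈ Γ.mem X → IsDelta06 B → A ∪ B ∈ Γ.mem X
  inter_delta : ∀ (X : Type) [TopologicalSpace X] (A B : Set X),
    A ∈ Γ.mem X → IsDelta06 B → A ∩ B ∈ Γ.mem X
  delta_subst : ∀ (X Y : Type) [TopologicalSpace X] [TopologicalSpace Y] (f : X → Y),
    Delta06Measurable f → ∀ A : Set Y, A ∈ Γ.mem Y → f ⁻¹' A ∈ Γ.mem X

/-- `Γ`-determinacy for games with moves in `S`: every `Γ` subset of `S^ω` is determined. -/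
def GammaDetOn (Γ : Pointclass) (S : Type) [TopologicalSpace S] : Prop :=
  ∀ A : Set (ℕ → S), A ∈ Γ.mem (ℕ → S) → GameDetermined A

/-- `(Γ, E)`-determinacy for an equivalence relation `E` on a space `X`: for every continuous
surjection `π : ω^ω → X` and every `E`-invariant `Γ` set `A ⊆ X`, the game `π⁻¹(A)` is
determined. -/
def GammaEDet (Γ : Pointclass) (X : Type) [TopologicalSpace X] (E : X → X → Prop) : Prop :=
  ∀ π : (ℕ → ℕ) → X, Continuous π → Function.Surjective π →
    ∀ A : Set X, A ∈ Γ.mem X →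
      (∀ x y : X, E x y → (x ∈ A ↔ y ∈ A)) → GameDetermined (π ⁻¹' A)

/-- The subshift of finite type of `2^ℤ` determined by the finite set `W` of forbidden words. -/
def SFT (W : Finset (List Bool)) : Set (ℤ → Bool) :=
  {x | ∀ (k : ℤ), ∀ w ∈ W, ¬ ∀ i : Fin w.length, x (k + (i : ℕ)) = w.get i}

/-- The shift equivalence relation on a subshift of `2^ℤ`. -/
def sftShiftRel (W : Finset (List Bool)) (x y : ↥(SFT W)) : Prop :=
  ∃ n : ℤ, ∀ k : ℤ, (x : ℤ → Bool) (k - n) = (y : ℤ → Bool) k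

/-! ### Runs and strategies -/

theorem initSeg_succ {S : Type*} (x : ℕ → S) (n : ℕ) :
    initSeg x (n + 1) = initSeg x n ++ [x n] := by
  simp [initSeg, -List.ofFn_succ, List.ofFn_succ_last]

/-- Strategies can be simulated along a translation `e` of moves: at the turns in `p` the move of
the lifted run `y` is given by the strategy `ρ`, at the other turns it is the translation of the
move of `x`; positions of `y` are computed from positions of `x`. -/
theorem exists_lift_run {S T : Type*} (ρ : List S → S) (e : T → S) (p : ℕ → Prop) :
    ∃ L : List T → List S, ∀ x : ℕ → T, ∃ y : ℕ → S,
      (∀ n, initSeg y n = L (initSeg x n)) ∧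
      (∀ n, p n → y n = ρ (initSeg y n)) ∧ ∀ n, ¬ p n → y n = e (x n) := by
  classical
  let step : List S → T → List S := fun s t => s ++ [if p s.length then ρ s else e t]
  let L : List T → List S := fun l => l.foldl step []
  refine ⟨L, fun x => ?_⟩
  let y : ℕ → S := fun n => if p n then ρ (L (initSeg x n)) else e (x n)
  have hy : ∀ n, initSeg y n = L (initSeg x n) := by
    intro n
    induction n with
    | zero => simp [initSeg, L]
    | succ n ih =>
      have hlen : (L (initSeg x n)).length = n := by rw [← ih]; simp [initSeg]
      rw [initSeg_succ, initSeg_succ, ih]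
      simp only [L, List.foldl_append, List.foldl_cons, List.foldl_nil]
      change _ = step (L (initSeg x n)) (x n)
      simp only [step, hlen, y]
      rfl
  refine ⟨y, hy, fun n hn => ?_, fun n hn => ?_⟩
  · rw [hy]; simp [y, hn]
  · simp [y, hn]

/-- Player II can play any prescribed moves against a strategy of player I. -/
theorem exists_followsStratI {S : Type*} (σ : List S → S) (z : ℕ → S) :
    ∃ y, FollowsStratI σ y ∧ ∀ n, y (2 * n + 1) = z n := by
  obtain ⟨L, hL⟩ := exists_lift_run σ (id : S → S) Even
  obtain ⟨y, -, h1, h2⟩ := hL fun n => z (n / 2)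
  refine ⟨y, fun n => h1 _ (by simp), fun n => ?_⟩
  rw [h2 _ (by simp)]
  simp only [id]
  congr 1
  omega

/-- Parity of a natural number, as a bit. -/
def natBit (n : ℕ) : Bool := n % 2 == 1

theorem natBit_toNat (b : Bool) : natBit b.toNat = b := by cases b <;> rfl

/-- A game on `ω` in which the moves are read modulo `2`, as long as the first move of player I is
smaller than `2`, and in which player II can win against any other first move of player I, is at
least as complicated as the game on `2`. -/
theorem gameDetermined_of_parity {A : Set (ℕ → Bool)} {C : Set (ℕ → ℕ)} (hC : GameDetermined C)
    (hlegal : ∀ y : ℕ → ℕ, y 0 < 2 → (y ∈ C ↔ (fun n => natBit (y n)) ∈ A))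
    (hillegal : ∃ z : ℕ → ℕ, ∀ y : ℕ → ℕ, 2 ≤ y 0 → (∀ n, y (2 * n + 1) = z n) → y ∉ C) :
    GameDetermined A := by
  rcases hC with ⟨σ, hσ⟩ | ⟨τ, hτ⟩
  · left
    obtain ⟨L, hL⟩ := exists_lift_run σ Bool.toNat Even
    have h0 : σ [] < 2 := by
      by_contra! h
      obtain ⟨z, hz⟩ := hillegal
      obtain ⟨y, hy, hyz⟩ := exists_followsStratI σ z
      refine hz y ?_ hyz (hσ y hy)
      simpa [initSeg] using h.trans_eq (hy 0).symm
    refine ⟨fun s => natBit (σ (L s)), fun x hx => ?_⟩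
    obtain ⟨y, hyL, h1, h2⟩ := hL x
    have hyx : (fun n => natBit (y n)) = x := by
      funext n
      rcases n.even_or_odd' with ⟨k, rfl | rfl⟩
      · rw [h1 _ (by simp), hyL, hx k]
      · rw [h2 _ (by simp), natBit_toNat]
    rw [← hyx, ← hlegal y]
    · exact hσ y fun n => h1 _ (by simp)
    · rw [h1 0 (by simp)]
      simpa [initSeg] using h0
  · right
    obtain ⟨L, hL⟩ := exists_lift_run τ Bool.toNat Odd
    refine ⟨fun s => natBit (τ (L s)), fun x hx => ?_⟩
    obtain ⟨y, hyL, h1, h2⟩ := hL x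
    have hyx : (fun n => natBit (y n)) = x := by
      funext n
      rcases n.even_or_odd' with ⟨k, rfl | rfl⟩
      · rw [h2 _ (by simp), natBit_toNat]
      · rw [h1 _ (by simp), hyL, hx k]
    rw [← hyx, ← hlegal y]
    · exact hτ y fun n => h1 _ (by simp)
    · rw [h2 0 (by simp)]
      exact Bool.toNat_lt _

/-! ### `Δ⁰₆` sets -/

section Delta

variable {X : Type} [TopologicalSpace X]

theorem compl_mem_sigmaLevel_succ {s : Set X} {n : ℕ} (h : s ∈ sigmaLevel X n) :
    sᶜ ∈ sigmaLevel X (n + 1) :=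
  ⟨fun _ => sᶜ, fun _ => by simpa using h, by simp [iUnion_const]⟩

theorem sigmaLevel_subset_succ [TopologicalSpace.MetrizableSpace X] (n : ℕ) :
    sigmaLevel X n ⊆ sigmaLevel X (n + 1) := by
  induction n with
  | zero =>
    intro s hs
    let := TopologicalSpace.metrizableSpaceMetric X
    obtain ⟨F, hF, -, hU, -⟩ := IsOpen.exists_iUnion_isClosed (U := s) hs
    exact ⟨F, fun k => (hF k).isOpen_compl, hU.symm⟩
  | succ n ih =>
    rintro s ⟨f, hf, rfl⟩
    exact ⟨f, fun k => ih (hf k), rfl⟩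

theorem IsDelta06.compl {s : Set X} (h : IsDelta06 s) : IsDelta06 sᶜ :=
  ⟨h.2, by simpa using h.1⟩

/-- Countable unions of closed sets are `Δ⁰₆`. -/
theorem isDelta06_iUnion_of_isClosed [TopologicalSpace.MetrizableSpace X] {ι : Type*} [Countable ι]
    [Nonempty ι] {F : ι → Set X} (hF : ∀ i, IsClosed (F i)) : IsDelta06 (⋃ i, F i) := by
  obtain ⟨g, hg⟩ := exists_surjective_nat ι
  have h1 : (⋃ i, F i) ∈ sigmaLevel X 1 :=
    ⟨fun k => F (g k), fun k => (hF _).isOpen_compl, (hg.iUnion_comp F).symm⟩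
  have h4 : (⋃ i, F i) ∈ sigmaLevel X 4 :=
    sigmaLevel_subset_succ 3 (sigmaLevel_subset_succ 2 (sigmaLevel_subset_succ 1 h1))
  exact ⟨sigmaLevel_subset_succ 4 h4, compl_mem_sigmaLevel_succ h4⟩

end Delta

/-! ### Perfectly many inequivalent points -/

instance isCountablyGenerated_uniformity_bool : (uniformity Bool).IsCountablyGenerated :=
  inferInstanceAs (Filter.principal _).IsCountablyGenerated

theorem exists_cylinder_subset_entourage {V : Set ((ℕ → Bool) × (ℕ → Bool))}
    (hV : V ∈ uniformity (ℕ → Bool)) :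
    ∃ m : ℕ, ∀ a b : ℕ → Bool, (∀ i < m, a i = b i) → (a, b) ∈ V := by
  rw [Pi.uniformity, Filter.mem_iInf] at hV
  obtain ⟨I, hI, W, hW, rfl⟩ := hV
  obtain ⟨m, hm⟩ := hI.bddAbove
  refine ⟨m + 1, fun a b hab => mem_iInter.2 fun i => ?_⟩
  obtain ⟨t, ht, hts⟩ := Filter.mem_comap.1 (hW i)
  apply hts
  simp only [mem_preimage]
  rw [hab i (Nat.lt_succ_of_le (hm i.2))]
  exact refl_mem_uniformity ht

theorem cylinder_mem_uniformity (m : ℕ) :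
    {p : (ℕ → Bool) × (ℕ → Bool) | ∀ i < m, p.1 i = p.2 i} ∈ uniformity (ℕ → Bool) := by
  have : ∀ᶠ p in uniformity (ℕ → Bool), ∀ i ∈ Set.Iio m, p.1 i = p.2 i := by
    rw [Filter.eventually_all_finite (Set.finite_Iio m)]
    intro i _
    have h := (Pi.uniformContinuous_proj (fun _ : ℕ => Bool) i)
    have h2 : {p : Bool × Bool | p.1 = p.2} ∈ uniformity Bool := by
      change _ ∈ Filter.principal _
      rw [Filter.mem_principal]
      rintro ⟨a, b⟩ h
      simpa using h
    exact h h2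
  exact this

theorem not_countable_cylinder (a : ℕ → Bool) (m : ℕ) :
    ¬ {b : ℕ → Bool | ∀ i < m, a i = b i}.Countable := by
  intro h
  let φ : (ℕ → Bool) → (ℕ → Bool) := fun z i => if i < m then a i else z (i - m)
  have hinj : Function.Injective φ := by
    intro z w hzw
    funext i
    simpa [φ] using congrFun hzw (i + m)
  have hc : (φ ⁻¹' {b : ℕ → Bool | ∀ i < m, a i = b i}).Countable :=
    h.preimage_of_injOn hinj.injOn
  have : φ ⁻¹' {b : ℕ → Bool | ∀ i < m, a i = b i} = univ := by
    ext z
    simp +contextual [φ]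
  rw [this, countable_univ_iff] at hc
  obtain ⟨g, hg⟩ := exists_surjective_nat (ℕ → Bool)
  obtain ⟨n, hn⟩ := hg fun k => ! g k k
  simpa using congrFun hn n

/-- Finitely many uncountable sets have pairwise unrelated representatives, if each point is
related to only countably many others. -/
theorem exists_pairwise_not_rel {ι Y : Type*} [Finite ι] {E : Y → Y → Prop}
    (hE : ∀ a, {b | E a b ∨ E b a}.Countable) {U : ι → Set Y} (hU : ∀ i, ¬ (U i).Countable) :
    ∃ c : ι → Y, (∀ i, c i ∈ U i) ∧ ∀ i j, i ≠ j → ¬ E (c i) (c j) := by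
  classical
  have := Fintype.ofFinite ι
  suffices H : ∀ s : Finset ι, ∃ c : ι → Y, (∀ i, c i ∈ U i) ∧
      ∀ i ∈ s, ∀ j ∈ s, i ≠ j → ¬ E (c i) (c j) by
    obtain ⟨c, h1, h2⟩ := H Finset.univ
    exact ⟨c, h1, fun i j => h2 i (by simp) j (by simp)⟩
  intro s
  induction s using Finset.induction_on with
  | empty =>
    have hne : ∀ i, (U i).Nonempty := fun i => by
      rw [nonempty_iff_ne_empty]
      intro h
      exact hU i (by simp [h])
    choose c hc using hne
    exact ⟨c, hc, by simp⟩
  | insert a s has ih =>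
    obtain ⟨c, h1, h2⟩ := ih
    have hcount : (⋃ i ∈ s, {b | E (c i) b ∨ E b (c i)}).Countable :=
      s.countable_toSet.biUnion fun i _ => hE (c i)
    obtain ⟨y, hyU, hy⟩ : ∃ y ∈ U a, y ∉ ⋃ i ∈ s, {b | E (c i) b ∨ E b (c i)} := by
      by_contra! h
      exact hU a (hcount.mono h)
    simp only [mem_iUnion, mem_ofPred_eq, not_exists, not_or] at hy
    refine ⟨Function.update c a y, fun i => ?_, fun i hi j hj hij => ?_⟩
    · by_cases hia : i = a
      · subst hia; simpa using hyU
      · simpa [hia] using h1 i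
    · rcases Finset.mem_insert.1 hi with rfl | hi' <;> rcases Finset.mem_insert.1 hj with rfl | hj'
      · exact absurd rfl hij
      · simpa [hij.symm] using (hy j hj').2
      · simpa [hij] using (hy i hi').1
      · have hia : i ≠ a := fun h => has (h ▸ hi')
        have hja : j ≠ a := fun h => has (h ▸ hj')
        simpa [hia, hja] using h2 i hi' j hj' hij

/-- A version of Mycielski's theorem: given countably many closed relations on the Cantor space
whose sections are countable, there is a continuous map of the Cantor space to itself sending
distinct points to unrelated points. -/
theorem exists_continuous_pairwise_not_rel {ι : Type*} [Countable ι]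
    (R : ι → (ℕ → Bool) → (ℕ → Bool) → Prop)
    (hclosed : ∀ n, IsClosed {p : (ℕ → Bool) × (ℕ → Bool) | R n p.1 p.2})
    (hcount : ∀ n a, {b | R n a b ∨ R n b a}.Countable) :
    ∃ k : (ℕ → Bool) → (ℕ → Bool), Continuous k ∧ ∀ x y, x ≠ y → ∀ n, ¬ R n (k x) (k y) := by
  let O : ι × ℕ → Set C(ℕ → Bool, ℕ → Bool) := fun q =>
    {k | ∀ x y : ℕ → Bool, x q.2 ≠ y q.2 → ¬ R q.1 (k x) (k y)}
  have hopen : ∀ q, IsOpen (O q) := by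
    rintro ⟨n, i⟩
    let K : Set ((ℕ → Bool) × (ℕ → Bool)) := {p | p.1 i ≠ p.2 i}
    have hK : IsCompact K := by
      apply IsClosed.isCompact
      have : IsClosed ((fun p : (ℕ → Bool) × (ℕ → Bool) => (p.1 i, p.2 i)) ⁻¹'
          {q : Bool × Bool | q.1 ≠ q.2}) :=
        (isClosed_discrete _).preimage (by fun_prop)
      exact this
    have hcont : Continuous fun k : C(ℕ → Bool, ℕ → Bool) => k.prodMap k := by
      refine ContinuousMap.continuous_of_continuous_uncurry _ ?_
      change Continuous fun q : C(ℕ → Bool, ℕ → Bool) × (ℕ → Bool) × (ℕ → Bool) =>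
        (q.1 q.2.1, q.1 q.2.2)
      fun_prop
    have := (ContinuousMap.isOpen_setOfPred_mapsTo hK (hclosed n).isOpen_compl).preimage hcont
    convert this using 1
    ext k
    simp [O, K, MapsTo]
  have hdense : ∀ q, Dense (O q) := by
    rintro ⟨n, i⟩ k
    rw [UniformSpace.mem_closure_iff_ball]
    intro V hV
    obtain ⟨V', hV', hVV⟩ :=
      ContinuousMap.hasBasis_compactConvergenceUniformity_of_compact.mem_iff.1 hV
    obtain ⟨m, hm⟩ := exists_cylinder_subset_entourage hV'
    have huc : UniformContinuous k := CompactSpace.uniformContinuous_of_continuous k.continuous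
    obtain ⟨m', hm'⟩ := exists_cylinder_subset_entourage (huc (cylinder_mem_uniformity m))
    let M := max m' (i + 1)
    let ext0 : (Fin M → Bool) → (ℕ → Bool) := fun s j => if h : j < M then s ⟨j, h⟩ else false
    let res : (ℕ → Bool) → (Fin M → Bool) := fun x j => x j
    obtain ⟨c, hcU, hcE⟩ := exists_pairwise_not_rel (hcount n)
      (fun s : Fin M → Bool => not_countable_cylinder (k (ext0 s)) m)
    have hres : Continuous res := by fun_prop
    let k' : C(ℕ → Bool, ℕ → Bool) := ⟨fun x => c (res x), continuous_of_discreteTopology.comp hres⟩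
    refine ⟨k', hVV fun x => hm _ _ fun j hj => ?_, fun x y hxy => hcE _ _ fun h => hxy ?_⟩
    · refine (hm' x (ext0 (res x)) (fun l hl => ?_) j hj).trans (hcU (res x) j hj)
      have : l < M := hl.trans_le (le_max_left _ _)
      simp [ext0, res, this]
    · exact congrFun h ⟨i, (Nat.lt_succ_self i).trans_le (le_max_right _ _)⟩
  obtain ⟨k, hk⟩ := (dense_iInter_of_isOpen hopen hdense).nonempty
  refine ⟨k, k.continuous, fun x y hxy n => ?_⟩
  obtain ⟨i, hi⟩ := Function.ne_iff.1 hxy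
  exact mem_iInter.1 hk (n, i) x y hi

/-! ### Subshifts -/

theorem isClosed_SFT (W : Finset (List Bool)) : IsClosed (SFT W) := by
  have : SFT W = ⋂ (k : ℤ), ⋂ w ∈ W,
      (fun (x : ℤ → Bool) (i : Fin w.length) => x (k + (i : ℕ))) ⁻¹' {w.get}ᶜ := by
    ext x
    simp [SFT, funext_iff]
  rw [this]
  refine isClosed_iInter fun k => isClosed_iInter fun w => isClosed_iInter fun _ => ?_
  exact (isClosed_discrete _).preimage (by fun_prop)

theorem sftShiftRel_symm {W : Finset (List Bool)} {x y : SFT W} (h : sftShiftRel W x y) :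
    sftShiftRel W y x := by
  obtain ⟨n, hn⟩ := h
  exact ⟨-n, fun k => by rw [← hn]; simp⟩

theorem sftShiftRel_trans {W : Finset (List Bool)} {x y z : SFT W} (h : sftShiftRel W x y)
    (h' : sftShiftRel W y z) : sftShiftRel W x z := by
  obtain ⟨n, hn⟩ := h
  obtain ⟨m, hm⟩ := h'
  exact ⟨m + n, fun k => by rw [← hm, ← hn]; ring_nf⟩

/-- In a subshift with uncountably many orbits, the Cantor space embeds continuously as a set of
pairwise inequivalent points. -/
theorem exists_continuous_inequivalent (W : Finset (List Bool))
    (huncount : ¬ ∃ f : ↥(SFT W) → ℕ, ∀ x y : ↥(SFT W), f x = f y → sftShiftRel W x y) :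
    ∃ h : (ℕ → Bool) → SFT W, Continuous h ∧ ∀ a b, sftShiftRel W (h a) (h b) → a = b := by
  have hunc : ¬ (SFT W).Countable := by
    intro hc
    obtain ⟨f, hf⟩ := @exists_injective_nat _ hc.to_subtype
    refine huncount ⟨f, fun x y hxy => ⟨0, fun k => ?_⟩⟩
    rw [hf hxy, sub_zero]
  obtain ⟨f, hfX, hfc, hfi⟩ := (isClosed_SFT W).exists_nat_bool_injection_of_not_countable hunc
  have hsub : ∀ (n : ℤ) (a b b' : ℕ → Bool), (∀ j, f a (j - n) = f b j) →
      (∀ j, f a (j - n) = f b' j) → b = b' := fun n a b b' h h' =>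
    hfi (funext fun j => (h j).symm.trans (h' j))
  have hsub' : ∀ (n : ℤ) (a b b' : ℕ → Bool), (∀ j, f b (j - n) = f a j) →
      (∀ j, f b' (j - n) = f a j) → b = b' := fun n a b b' h h' =>
    hfi (funext fun j => by simpa using (h (j + n)).trans (h' (j + n)).symm)
  obtain ⟨k, hkc, hk⟩ := exists_continuous_pairwise_not_rel
    (fun (n : ℤ) a b => ∀ j, f a (j - n) = f b j)
    (fun n => by
      have : IsClosed {p : (ℕ → Bool) × (ℕ → Bool) | (fun j => f p.1 (j - n)) = f p.2} :=
        isClosed_eq (by fun_prop) (by fun_prop)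
      simpa only [funext_iff] using this)
    (fun n a => by
      rw [ofPred_or]
      exact (Set.Subsingleton.countable fun b hb b' hb' => hsub n a b b' hb hb').union
        (Set.Subsingleton.countable fun b hb b' hb' => hsub' n a b b' hb hb'))
  refine ⟨fun a => ⟨f (k a), hfX (mem_range_self _)⟩, by fun_prop, fun a b ⟨n, hn⟩ => ?_⟩
  by_contra hab
  exact hk a b hab n hn

/-- Saturations of closed sets under a continuous map from the Cantor space are `Δ⁰₆`, and more
generally those of countable unions of closed sets. -/
theorem isDelta06_saturation {W : Finset (List Bool)} {h : (ℕ → Bool) → SFT W} (hc : Continuous h)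
    {F : ℕ → Set (ℕ → Bool)} (hF : ∀ i, IsClosed (F i)) :
    IsDelta06 {z : SFT W | ∃ a ∈ ⋃ i, F i, sftShiftRel W z (h a)} := by
  have : {z : SFT W | ∃ a ∈ ⋃ i, F i, sftShiftRel W z (h a)} = ⋃ q : ℤ × ℕ,
      (fun (z : SFT W) (k : ℤ) => z.1 (k - q.1)) ⁻¹' ((fun a => (h a).1) '' F q.2) := by
    ext z
    simp only [mem_iUnion, mem_ofPred_eq, mem_preimage, mem_image, sftShiftRel, Prod.exists,
      funext_iff]
    constructor
    · rintro ⟨a, ⟨i, hi⟩, n, hn⟩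
      exact ⟨n, i, a, hi, fun k => (hn k).symm⟩
    · rintro ⟨n, i, a, hi, hn⟩
      exact ⟨a, ⟨i, hi⟩, n, fun k => (hn k).symm⟩
  rw [this]
  refine isDelta06_iUnion_of_isClosed fun q => ?_
  exact ((hF q.2).isCompact.image (by fun_prop)).isClosed.preimage <|
    continuous_pi fun k => (continuous_apply (k - q.1)).comp continuous_subtype_val

/-- Saturations of sets in a reasonable pointclass, under a continuous map from the Cantor space
with inequivalent values, stay in the pointclass. -/
theorem saturation_mem {Γ : Pointclass} (hΓ : Reasonable Γ) {W : Finset (List Bool)}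
    {h : (ℕ → Bool) → SFT W} (hc : Continuous h)
    (hinj : ∀ a b, sftShiftRel W (h a) (h b) → a = b) {A : Set (ℕ → Bool)}
    (hA : A ∈ Γ.mem (ℕ → Bool)) :
    {z : SFT W | ∃ a ∈ A, sftShiftRel W z (h a)} ∈ Γ.mem (SFT W) := by
  classical
  let sat : Set (ℕ → Bool) → Set (SFT W) := fun S => {z | ∃ a ∈ S, sftShiftRel W z (h a)}
  have hsat_closed : ∀ S, IsClosed S → IsDelta06 (sat S) := fun S hS => by
    simpa [sat, iUnion_const] using isDelta06_saturation hc (F := fun _ => S) fun _ => hS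
  have hsat_open : ∀ U, IsOpen U → IsDelta06 (sat U) := fun U hU => by
    let := TopologicalSpace.metrizableSpaceMetric (ℕ → Bool)
    obtain ⟨F, hF, -, hFU, -⟩ := hU.exists_iUnion_isClosed
    simpa only [hFU] using isDelta06_saturation hc hF
  let c : ℕ → Bool := fun _ => false
  let r : SFT W → (ℕ → Bool) := fun z =>
    if hz : ∃ a, sftShiftRel W z (h a) then hz.choose else c
  have hr : ∀ z a, sftShiftRel W z (h a) → r z = a := fun z a hz => by
    have hex : ∃ a, sftShiftRel W z (h a) := ⟨a, hz⟩
    simp only [r, dif_pos hex]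
    exact hinj _ _ (sftShiftRel_trans (sftShiftRel_symm hex.choose_spec) hz)
  have hr' : ∀ z, (¬ ∃ a, sftShiftRel W z (h a)) → r z = c := fun z hz => dif_neg hz
  have hpre : ∀ S, c ∉ S → r ⁻¹' S = sat S := by
    intro S hS
    ext z
    constructor
    · intro hz
      by_cases hex : ∃ a, sftShiftRel W z (h a)
      · obtain ⟨a, ha⟩ := hex
        exact ⟨a, by simpa [hr z a ha] using hz, ha⟩
      · exact absurd (by simpa [hr' z hex] using hz) hS
    · rintro ⟨a, ha, hza⟩
      simpa [hr z a hza] using ha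
  have hmeas : Delta06Measurable r := by
    intro U hU
    by_cases hcU : c ∈ U
    · have := (hsat_closed Uᶜ hU.isClosed_compl).compl
      rwa [← hpre Uᶜ (by simpa using hcU), preimage_compl, compl_compl] at this
    · rw [hpre U hcU]
      exact hsat_open U hU
  have := hΓ.inter_delta _ _ _ (hΓ.delta_subst _ _ r hmeas A hA) (hsat_closed univ isClosed_univ)
  convert this using 1
  ext z
  constructor
  · rintro ⟨a, ha, hza⟩
    exact ⟨by simpa [hr z a hza] using ha, a, mem_univ a, hza⟩
  · rintro ⟨hz, a, -, hza⟩
    exact ⟨a, by simpa [hr z a hza] using hz, hza⟩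

theorem stmt11 (Γ : Pointclass) (hΓ : Reasonable Γ) (W : Finset (List Bool))
    (huncount : ¬ ∃ f : ↥(SFT W) → ℕ, ∀ x y : ↥(SFT W), f x = f y → sftShiftRel W x y)
    (hdet : GammaEDet Γ ↥(SFT W) (sftShiftRel W)) :
    GammaDetOn Γ Bool := by
  classical
  intro A hA
  by_cases hAuniv : A = univ
  · exact Or.inl ⟨fun _ => false, fun x _ => hAuniv ▸ mem_univ x⟩
  obtain ⟨a₀, ha₀⟩ := (ne_univ_iff_exists_notMem A).1 hAuniv
  obtain ⟨h, hc, hinj⟩ := exists_continuous_inequivalent W huncount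
  have : PolishSpace (SFT W) := (isClosed_SFT W).polishSpace
  have : Nonempty (SFT W) := ⟨h a₀⟩
  obtain ⟨g, hgc, hgs⟩ := PolishSpace.exists_nat_nat_continuous_surjective (SFT W)
  let B : Set (SFT W) := {z | ∃ a ∈ A, sftShiftRel W z (h a)}
  have hB : ∀ a, h a ∈ B ↔ a ∈ A := fun a =>
    ⟨fun ⟨b, hb, hab⟩ => hinj a b hab ▸ hb, fun ha => ⟨a, ha, 0, fun k => by rw [sub_zero]⟩⟩
  -- A first move of player I other than `0` or `1` hands the choice of the point to player II.
  let π : (ℕ → ℕ) → SFT W := fun y =>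
    if y 0 < 2 then h fun n => natBit (y n) else g fun n => y (2 * n + 1)
  have hclopen : IsClopen {y : ℕ → ℕ | y 0 < 2} :=
    (isClopen_discrete (Iio 2)).preimage (continuous_apply 0)
  have hbit : Continuous fun (y : ℕ → ℕ) n => natBit (y n) :=
    continuous_pi fun n =>
      (continuous_of_discreteTopology (f := natBit)).comp (continuous_apply n)
  have hπc : Continuous π := by
    refine Continuous.if (fun y hy => ?_) (hc.comp hbit) (hgc.comp (by fun_prop))
    rw [hclopen.frontier_eq] at hy
    exact absurd hy (notMem_empty y)
  have hπs : Function.Surjective π := fun z => by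
    obtain ⟨w, rfl⟩ := hgs z
    refine ⟨fun n => if n = 0 then 2 else w (n / 2), ?_⟩
    simp only [π, if_true, lt_irrefl, if_false]
    congr 1
    funext n
    rw [if_neg (by omega)]
    congr 1
    omega
  have hinv : ∀ x y, sftShiftRel W x y → (x ∈ B ↔ y ∈ B) := fun x y hxy =>
    ⟨fun ⟨a, ha, hxa⟩ => ⟨a, ha, sftShiftRel_trans (sftShiftRel_symm hxy) hxa⟩,
      fun ⟨a, ha, hya⟩ => ⟨a, ha, sftShiftRel_trans hxy hya⟩⟩
  refine gameDetermined_of_parity (hdet π hπc hπs B (saturation_mem hΓ hc hinj hA) hinv)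
    (fun y hy => ?_) ?_
  · simp only [mem_preimage, π, if_pos hy, hB]
  · obtain ⟨z, hz⟩ := hgs (h a₀)
    refine ⟨z, fun y hy hyz => ?_⟩
    simp only [mem_preimage, π, if_neg (not_lt.2 hy), hyz, hz, hB]
    exact ha₀
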